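/- The complement of D = {H(S) : S a set of positive integers with 1 ∈ S} in the interval [6/π², 1] is exactly the union, over all finite sets S₁ = {s(1) < ... < s(k)} of positive integers with s(1) = 1 and k ≥ 2, of the open intervals (H(S₂), H(S₁)), where S₂ = {s(1), ..., s(k−1)} ∪ {m : m ≥ s(k) + 1}. In particular, D has countably many gaps. -/

import Mathlib

open scoped Classical

/-- `charFn S` is the characteristic function `u` of a set `S` of positive integers. -/
noncomputable def charFn (S : Set ℕ) (n : ℕ) : ℝ := if n ∈ S then 1 else 0

/-- `H S = ∏_p (1 + Σ_{i ≥ 2} (u(i) - u(i-1)) / p^i)`, the product over all primes. -/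
noncomputable def H (S : Set ℕ) : ℝ :=
  ∏' p : Nat.Primes,
    (1 + ∑' i : ℕ, (charFn S (i + 2) - charFn S (i + 1)) / ((p : ℕ) : ℝ) ^ (i + 2))

/-- The exponentially `S`-numbers: positive integers all of whose prime-factorization
exponents lie in `S`. -/
def ExpS (S : Set ℕ) : Set ℕ :=
  {N | 0 < N ∧ ∀ p : ℕ, p.Prime → p ∣ N → N.factorization p ∈ S}

/-- The set `D` of all densities `H S` as `S` ranges over sets of positive integers
containing `1`. -/
noncomputable def densitySet : Set ℝ :=
  {x | ∃ S : Set ℕ, 1 ∈ S ∧ (∀ n ∈ S, 0 < n) ∧ H S = x}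

open Filter Topology

/-- The generating series `∑_{i ≥ 1} u(i) r ^ i` of the characteristic function of `S`. -/
noncomputable def charSeries (S : Set ℕ) (r : ℝ) : ℝ := ∑' i : ℕ, charFn S (i + 1) * r ^ (i + 1)

/-- The Euler factor of `H S` as a function of `r = 1 / p`. -/
noncomputable def eulerFactor (S : Set ℕ) (r : ℝ) : ℝ := (1 - r) * (1 + charSeries S r)

lemma charFn_nonneg (S : Set ℕ) (n : ℕ) : 0 ≤ charFn S n := by
  unfold charFn; split_ifs <;> norm_num

lemma charFn_le_one (S : Set ℕ) (n : ℕ) : charFn S n ≤ 1 := by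
  unfold charFn; split_ifs <;> norm_num

lemma charFn_mul_le (S : Set ℕ) (n : ℕ) {x : ℝ} (hx : 0 ≤ x) : charFn S n * x ≤ x := by
  simpa using mul_le_mul_of_nonneg_right (charFn_le_one S n) hx

section Series

variable {r : ℝ}

lemma hasSum_pow_add (h0 : 0 ≤ r) (h1 : r < 1) (k : ℕ) :
    HasSum (fun i : ℕ => r ^ (i + k)) (r ^ k / (1 - r)) := by
  simpa [pow_add, div_eq_mul_inv, mul_comm] using
    (hasSum_geometric_of_lt_one h0 h1).mul_right (r ^ k)

lemma summable_charFn_mul_pow (S : Set ℕ) (h0 : 0 ≤ r) (h1 : r < 1) (k : ℕ) :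
    Summable fun i : ℕ => charFn S (i + k) * r ^ (i + k) :=
  .of_nonneg_of_le (fun _ => mul_nonneg (charFn_nonneg _ _) (by positivity))
    (fun _ => charFn_mul_le _ _ (by positivity)) (hasSum_pow_add h0 h1 k).summable

lemma charSeries_mono {S T : Set ℕ} (h : S ⊆ T) (h0 : 0 ≤ r) (h1 : r < 1) :
    charSeries S r ≤ charSeries T r := by
  refine (summable_charFn_mul_pow S h0 h1 1).tsum_le_tsum (fun i => ?_)
    (summable_charFn_mul_pow T h0 h1 1)
  refine mul_le_mul_of_nonneg_right ?_ (by positivity)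
  unfold charFn
  split_ifs with hS hT
  · rfl
  · exact absurd (h hS) hT
  · norm_num
  · rfl

lemma charSeries_singleton_one (r : ℝ) : charSeries {1} r = r := by
  unfold charSeries
  rw [tsum_eq_single 0 (fun i hi => by simp [charFn, hi])]
  simp [charFn]

lemma charSeries_le (S : Set ℕ) (h0 : 0 ≤ r) (h1 : r < 1) : charSeries S r ≤ r / (1 - r) := by
  have h := hasSum_pow_add h0 h1 1
  rw [pow_one] at h
  rw [← h.tsum_eq]
  exact (summable_charFn_mul_pow S h0 h1 1).tsum_le_tsum
    (fun i => charFn_mul_le _ _ (by positivity)) h.summable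

lemma charSeries_positives (h0 : 0 ≤ r) (h1 : r < 1) :
    charSeries {n | 0 < n} r = r / (1 - r) := by
  simpa [charSeries, charFn] using (hasSum_pow_add h0 h1 1).tsum_eq

lemma charSeries_add_gap_le {S T : Set ℕ} {t : ℕ} (ht : 1 ≤ t) (hS : t ∈ S) (hT : t ∉ T)
    (h : ∀ m < t, m ∈ S ↔ m ∈ T) (h0 : 0 ≤ r) (h1 : r < 1) :
    charSeries T r + (r ^ t - r ^ (t + 1) / (1 - r)) ≤ charSeries S r := by
  obtain ⟨k, rfl⟩ : ∃ k, t = k + 1 := ⟨t - 1, by omega⟩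
  have eS := (summable_charFn_mul_pow S h0 h1 1).sum_add_tsum_nat_add k
  have eT := (summable_charFn_mul_pow T h0 h1 1).sum_add_tsum_nat_add (k + 1)
  have hfin : ∑ i ∈ Finset.range k, charFn S (i + 1) * r ^ (i + 1) =
      ∑ i ∈ Finset.range k, charFn T (i + 1) * r ^ (i + 1) := by
    refine Finset.sum_congr rfl fun i hi => ?_
    have := h (i + 1) (by simpa using hi)
    simp [charFn, this]
  have hS' : r ^ (k + 1) ≤ ∑' i : ℕ, charFn S (i + k + 1) * r ^ (i + k + 1) := by
    have := (summable_charFn_mul_pow S h0 h1 (k + 1)).le_tsum 0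
      (fun _ _ => mul_nonneg (charFn_nonneg _ _) (by positivity))
    simpa [charFn, hS, ← add_assoc] using this
  have hT' : ∑' i : ℕ, charFn T (i + (k + 1) + 1) * r ^ (i + (k + 1) + 1) ≤
      r ^ (k + 1 + 1) / (1 - r) := by
    rw [← (hasSum_pow_add h0 h1 (k + 1 + 1)).tsum_eq]
    exact (summable_charFn_mul_pow T h0 h1 (k + 1 + 1)).tsum_le_tsum
      (fun i => charFn_mul_le _ _ (by positivity)) (hasSum_pow_add h0 h1 _).summable
  have hz : charFn T (k + 1) = 0 := by simp [charFn, hT]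
  rw [Finset.sum_range_succ, hz] at eT
  unfold charSeries
  linarith

lemma gap_nonneg (h0 : 0 ≤ r) (h2 : r ≤ 1 / 2) (t : ℕ) :
    0 ≤ r ^ t - r ^ (t + 1) / (1 - r) := by
  rw [sub_nonneg, div_le_iff₀ (by linarith), pow_succ]
  exact mul_le_mul_of_nonneg_left (by linarith) (by positivity)

lemma gap_pos (h0 : 0 < r) (h2 : r < 1 / 2) (t : ℕ) :
    0 < r ^ t - r ^ (t + 1) / (1 - r) := by
  rw [sub_pos, div_lt_iff₀ (by linarith), pow_succ]
  exact mul_lt_mul_of_pos_left (by linarith) (by positivity)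

lemma one_sub_sq_le_eulerFactor {S : Set ℕ} (hS : 1 ∈ S) (h0 : 0 ≤ r) (h1 : r < 1) :
    1 - r ^ 2 ≤ eulerFactor S r := by
  have := charSeries_mono (Set.singleton_subset_iff.2 hS) h0 h1
  rw [charSeries_singleton_one] at this
  unfold eulerFactor
  nlinarith

lemma eulerFactor_le_one (S : Set ℕ) (h0 : 0 ≤ r) (h1 : r < 1) : eulerFactor S r ≤ 1 := by
  have h := charSeries_le S h0 h1
  rw [le_div_iff₀ (by linarith)] at h
  unfold eulerFactor
  linarith

lemma eulerFactor_pos {S : Set ℕ} (hS : 1 ∈ S) (h0 : 0 ≤ r) (h1 : r < 1) :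
    0 < eulerFactor S r :=
  lt_of_lt_of_le (by nlinarith) (one_sub_sq_le_eulerFactor hS h0 h1)

lemma abs_log_eulerFactor_le {S : Set ℕ} (hS : 1 ∈ S) (h0 : 0 ≤ r) (h2 : r ≤ 1 / 2) :
    |Real.log (eulerFactor S r)| ≤ 2 * r ^ 2 := by
  have h1 : r < 1 := by linarith
  have hlo := one_sub_sq_le_eulerFactor hS h0 h1
  have hpos := eulerFactor_pos hS h0 h1
  have hlog := Real.one_sub_inv_le_log_of_pos hpos
  rw [abs_of_nonpos (Real.log_nonpos hpos.le (eulerFactor_le_one S h0 h1))]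
  have : (eulerFactor S r)⁻¹ ≤ 1 + 2 * r ^ 2 := by
    rw [inv_le_iff_one_le_mul₀ hpos]
    nlinarith [sq_nonneg r, mul_nonneg (sq_nonneg r) (by nlinarith : (0 : ℝ) ≤ 1 / 2 - r ^ 2)]
  linarith

lemma eulerFactor_eq {S : Set ℕ} (hS : 1 ∈ S) (h0 : 0 ≤ r) (h1 : r < 1) :
    1 + ∑' i : ℕ, (charFn S (i + 2) - charFn S (i + 1)) * r ^ (i + 2) = eulerFactor S r := by
  have e1 := (summable_charFn_mul_pow S h0 h1 1).sum_add_tsum_nat_add 1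
  have e2 := (summable_charFn_mul_pow S h0 h1 1).tsum_mul_left r
  have e3 := (summable_charFn_mul_pow S h0 h1 2).tsum_sub
    ((summable_charFn_mul_pow S h0 h1 1).mul_left r)
  have hc : charFn S 1 = 1 := by simp [charFn, hS]
  have e4 : ∑' i : ℕ, (charFn S (i + 2) - charFn S (i + 1)) * r ^ (i + 2) =
      ∑' i : ℕ, (charFn S (i + 2) * r ^ (i + 2) - r * (charFn S (i + 1) * r ^ (i + 1))) :=
    tsum_congr fun i => by ring
  simp only [Finset.sum_range_one, zero_add, hc, pow_one, one_mul, add_assoc,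
    one_add_one_eq_two] at e1
  rw [e4, e3, e2]
  unfold eulerFactor charSeries
  rw [← e1]
  ring

end Series

namespace Nat.Primes

lemma inv_pos (p : Nat.Primes) : 0 < ((p : ℕ) : ℝ)⁻¹ := by
  have := p.2.pos
  positivity

lemma inv_le_half (p : Nat.Primes) : ((p : ℕ) : ℝ)⁻¹ ≤ 1 / 2 := by
  rw [one_div]
  exact inv_anti₀ (by norm_num) (by exact_mod_cast p.2.two_le)

lemma inv_lt_one (p : Nat.Primes) : ((p : ℕ) : ℝ)⁻¹ < 1 :=
  lt_of_le_of_lt p.inv_le_half (by norm_num)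

lemma summable_two_mul_inv_sq : Summable fun p : Nat.Primes => 2 * (((p : ℕ) : ℝ)⁻¹) ^ 2 := by
  have h : Summable fun n : ℕ => 2 * ((n : ℝ)⁻¹) ^ 2 := by
    simpa using (Real.summable_nat_pow_inv.2 one_lt_two).mul_left 2
  exact h.comp_injective Subtype.val_injective

end Nat.Primes

lemma H_eq_tprod {S : Set ℕ} (hS : 1 ∈ S) :
    H S = ∏' p : Nat.Primes, eulerFactor S ((p : ℕ) : ℝ)⁻¹ := by
  unfold H
  refine tprod_congr fun p => ?_
  rw [← eulerFactor_eq hS p.inv_pos.le p.inv_lt_one]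
  simp only [inv_pow, div_eq_mul_inv]

lemma summable_log_eulerFactor {S : Set ℕ} (hS : 1 ∈ S) :
    Summable fun p : Nat.Primes => Real.log (eulerFactor S ((p : ℕ) : ℝ)⁻¹) :=
  Nat.Primes.summable_two_mul_inv_sq.of_norm_bounded
    fun p => abs_log_eulerFactor_le hS p.inv_pos.le p.inv_le_half

lemma H_eq_exp {S : Set ℕ} (hS : 1 ∈ S) :
    H S = Real.exp (∑' p : Nat.Primes, Real.log (eulerFactor S ((p : ℕ) : ℝ)⁻¹)) := by
  rw [H_eq_tprod hS, Real.rexp_tsum_eq_tprod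
    (fun p => eulerFactor_pos hS p.inv_pos.le p.inv_lt_one) (summable_log_eulerFactor hS)]

lemma log_eulerFactor_le {S T : Set ℕ} (hS : 1 ∈ S) (p : Nat.Primes)
    (h : charSeries S ((p : ℕ) : ℝ)⁻¹ ≤ charSeries T ((p : ℕ) : ℝ)⁻¹) :
    Real.log (eulerFactor S ((p : ℕ) : ℝ)⁻¹) ≤ Real.log (eulerFactor T ((p : ℕ) : ℝ)⁻¹) :=
  Real.log_le_log (eulerFactor_pos hS p.inv_pos.le p.inv_lt_one)
    (mul_le_mul_of_nonneg_left (by linarith) (sub_nonneg.2 p.inv_lt_one.le))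

lemma H_mono {S T : Set ℕ} (hS : 1 ∈ S) (h : S ⊆ T) : H S ≤ H T := by
  rw [H_eq_exp hS, H_eq_exp (h hS)]
  exact Real.exp_le_exp.2 ((summable_log_eulerFactor hS).tsum_le_tsum
    (fun p => log_eulerFactor_le hS p (charSeries_mono h p.inv_pos.le p.inv_lt_one))
    (summable_log_eulerFactor (h hS)))

/-- `H` is strictly increasing for the lexicographic order on characteristic functions. -/
lemma H_lt_H_of_lex {S T : Set ℕ} {t : ℕ} (hS1 : 1 ∈ S) (hT1 : 1 ∈ T) (ht : 1 ≤ t)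
    (hS : t ∈ S) (hT : t ∉ T) (h : ∀ m < t, m ∈ S ↔ m ∈ T) : H T < H S := by
  rw [H_eq_exp hS1, H_eq_exp hT1]
  refine Real.exp_lt_exp.2 (Summable.tsum_lt_tsum (i := ⟨3, Nat.prime_three⟩) (fun p => ?_) ?_
    (summable_log_eulerFactor hT1) (summable_log_eulerFactor hS1))
  · refine log_eulerFactor_le hT1 p ?_
    have h1 := charSeries_add_gap_le ht hS hT h p.inv_pos.le p.inv_lt_one
    have h2 := gap_nonneg p.inv_pos.le p.inv_le_half t
    linarith
  · have h0 : (0 : ℝ) < ((3 : ℕ) : ℝ)⁻¹ := by norm_num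
    have h3 : ((3 : ℕ) : ℝ)⁻¹ < 1 := by norm_num
    have h1 := charSeries_add_gap_le ht hS hT h h0.le h3
    have h2 := gap_pos h0 (by norm_num) t
    exact Real.log_lt_log (eulerFactor_pos hT1 h0.le h3)
      (mul_lt_mul_of_pos_left (by linarith) (sub_pos.2 h3))

lemma tendsto_H {S : ℕ → Set ℕ} {A : Set ℕ} (hS : ∀ n, 1 ∈ S n) (hA : 1 ∈ A)
    {l : Filter ℕ} (h : ∀ m, ∀ᶠ n in l, (m ∈ S n ↔ m ∈ A)) :
    Tendsto (fun n => H (S n)) l (𝓝 (H A)) := by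
  simp only [H_eq_exp (hS _), H_eq_exp hA]
  refine (Real.continuous_exp.tendsto _).comp ?_
  refine tendsto_tsum_of_dominated_convergence Nat.Primes.summable_two_mul_inv_sq (fun p => ?_)
    (.of_forall fun n p => abs_log_eulerFactor_le (hS n) p.inv_pos.le p.inv_le_half)
  refine Tendsto.log ?_ (eulerFactor_pos hA p.inv_pos.le p.inv_lt_one).ne'
  refine (Tendsto.const_add 1 ?_).const_mul _
  refine tendsto_tsum_of_dominated_convergence
    (hasSum_pow_add p.inv_pos.le p.inv_lt_one 1).summable (fun i => ?_) (.of_forall fun n i => ?_)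
  · refine tendsto_const_nhds.congr' ?_
    filter_upwards [h (i + 1)] with n hn
    simp [charFn, hn]
  · have hp : 0 ≤ (((p : ℕ) : ℝ)⁻¹) ^ (i + 1) := pow_nonneg p.inv_pos.le _
    rw [Real.norm_of_nonneg (mul_nonneg (charFn_nonneg _ _) hp)]
    exact charFn_mul_le _ _ hp

lemma H_positives : H {n | 0 < n} = 1 := by
  rw [H_eq_tprod (by simp), ← tprod_one (β := Nat.Primes)]
  refine tprod_congr fun p => ?_
  have : 1 - ((p : ℕ) : ℝ)⁻¹ ≠ 0 := (sub_pos.2 p.inv_lt_one).ne'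
  rw [eulerFactor, charSeries_positives p.inv_pos.le p.inv_lt_one]
  rw [mul_add, mul_div_cancel₀ _ this]
  ring

lemma H_singleton_one : H {1} = 6 / Real.pi ^ 2 := by
  let f : ℕ →*₀ ℝ :=
    { toFun := fun n => 1 / (n : ℝ) ^ 2
      map_zero' := by simp
      map_one' := by simp
      map_mul' := fun m n => by push_cast; ring }
  have hf : HasSum (fun n => f n) (Real.pi ^ 2 / 6) := hasSum_zeta_two
  have h := EulerProduct.eulerProduct_completely_multiplicative_hasProd (f := f) hf.summable.norm
  rw [hf.tsum_eq] at h
  have h' := (h.inv₀ (by positivity)).tprod_eq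
  rw [inv_div] at h'
  rw [← h', H_eq_tprod (Set.mem_singleton 1)]
  refine tprod_congr fun p => ?_
  rw [eulerFactor, charSeries_singleton_one]
  simp [f]
  ring

/-- The greedy approximations of `x` from below by values of `H`: the element `n + 2` is added
whenever this keeps the value at most `x`. -/
noncomputable def greedy (x : ℝ) : ℕ → Set ℕ
  | 0 => {1}
  | n + 1 => if H (insert (n + 2) (greedy x n)) ≤ x then insert (n + 2) (greedy x n)
      else greedy x n

section Greedy

variable {x : ℝ}

lemma greedy_succ_cases (x : ℝ) (n : ℕ) :
    greedy x (n + 1) = insert (n + 2) (greedy x n) ∨ greedy x (n + 1) = greedy x n := by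
  rw [greedy]; split_ifs <;> simp

lemma greedy_mono (x : ℝ) : Monotone (greedy x) := by
  refine monotone_nat_of_le_succ fun n => ?_
  rcases greedy_succ_cases x n with h | h <;> rw [h]
  exact Set.subset_insert _ _

lemma one_mem_greedy (x : ℝ) (n : ℕ) : 1 ∈ greedy x n := greedy_mono x n.zero_le rfl

lemma greedy_bounds (x : ℝ) (n : ℕ) : ∀ m ∈ greedy x n, 0 < m ∧ m ≤ n + 1 := by
  induction n with
  | zero => rintro m rfl; simp
  | succ n ih =>
    intro m hm
    rcases greedy_succ_cases x n with h | h <;> rw [h] at hm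
    · rcases hm with rfl | hm
      · omega
      · have := ih m hm; omega
    · have := ih m hm; omega

lemma mem_greedy_of_le (x : ℝ) {m n k : ℕ} (hm : m ≤ n + 1) (h : m ∈ greedy x k) :
    m ∈ greedy x n := by
  induction k with
  | zero => exact greedy_mono x n.zero_le h
  | succ k ih =>
    rcases greedy_succ_cases x k with h' | h'
    · rcases h' ▸ h with rfl | hk
      · exact greedy_mono x (by omega) h
      · exact ih hk
    · exact ih (h' ▸ h)

lemma H_greedy_le (hx : 6 / Real.pi ^ 2 ≤ x) (n : ℕ) : H (greedy x n) ≤ x := by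
  induction n with
  | zero => exact H_singleton_one.trans_le hx
  | succ n ih => rw [greedy]; split_ifs with h <;> assumption

lemma lt_H_insert_greedy {n : ℕ} (h : n + 2 ∉ greedy x (n + 1)) :
    x < H (insert (n + 2) (greedy x n)) := by
  by_contra! hle
  rw [greedy, if_pos hle] at h
  exact h (Set.mem_insert _ _)

lemma mem_greedy_iff (x : ℝ) {m n : ℕ} (hm : m ≤ n + 1) :
    m ∈ greedy x n ↔ m ∈ ⋃ k, greedy x k :=
  ⟨fun h => Set.mem_iUnion.2 ⟨n, h⟩, fun h => by
    obtain ⟨k, hk⟩ := Set.mem_iUnion.1 h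
    exact mem_greedy_of_le x hm hk⟩

/-- A value in the range of `H` that is not attained lies in one of the gaps. -/
lemma exists_gap (hx : 6 / Real.pi ^ 2 ≤ x) (hx1 : x ≤ 1) (hD : x ∉ densitySet) :
    ∃ S₁ : Set ℕ, ∃ t : ℕ, S₁.Finite ∧ 1 ∈ S₁ ∧ (∀ n ∈ S₁, 0 < n) ∧
      t ∈ S₁ ∧ (∀ m ∈ S₁, m ≤ t) ∧ 1 < t ∧
      x ∈ Set.Ioo (H ((S₁ \ {t}) ∪ {m : ℕ | t + 1 ≤ m})) (H S₁) := by
  set A : Set ℕ := ⋃ k, greedy x k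
  have h1A : 1 ∈ A := Set.mem_iUnion.2 ⟨0, one_mem_greedy x 0⟩
  have hpos : ∀ n ∈ A, 0 < n := fun n hn => by
    obtain ⟨k, hk⟩ := Set.mem_iUnion.1 hn
    exact (greedy_bounds x k n hk).1
  have hlim : Tendsto (fun n => H (greedy x n)) atTop (𝓝 (H A)) := by
    refine tendsto_H (one_mem_greedy x) h1A fun m => ?_
    filter_upwards [eventually_ge_atTop m] with n hn
    exact mem_greedy_iff x (by omega)
  have hle : H A ≤ x := le_of_tendsto' hlim (H_greedy_le hx)
  have hlt : H A < x := lt_of_le_of_ne hle fun h => hD ⟨A, h1A, hpos, h⟩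
  have hlim' : Tendsto (fun n => H (insert (n + 2) (greedy x n))) atTop (𝓝 (H A)) := by
    refine tendsto_H (fun n => Set.mem_insert_of_mem _ (one_mem_greedy x n)) h1A fun m => ?_
    filter_upwards [eventually_ge_atTop m] with n hn
    rw [Set.mem_insert_iff, or_iff_right (by omega)]
    exact mem_greedy_iff x (by omega)
  obtain ⟨N, hN⟩ := eventually_atTop.1 (hlim'.eventually_lt_const hlt)
  have hbig : ∀ n ≥ N, n + 2 ∈ A := fun n hn => by
    by_contra hnA
    exact lt_asymm (hN n hn)
      (lt_H_insert_greedy fun h => hnA (Set.mem_iUnion.2 ⟨_, h⟩))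
  have hex : ∃ n, n + 2 ∉ A := by
    by_contra! hall
    refine absurd hx1 (not_le.2 (H_positives ▸ lt_of_le_of_lt (H_mono (by simp) ?_) hlt))
    rintro (_ | _ | n) hn
    · simp at hn
    · exact h1A
    · exact hall n
  obtain ⟨n₀, hn₀⟩ := hex
  have hn₀N : n₀ ≤ N := by
    by_contra! h
    exact hn₀ (hbig _ h.le)
  set n := Nat.findGreatest (fun n => n + 2 ∉ A) N
  have hnA : n + 2 ∉ A := Nat.findGreatest_spec (P := fun n => n + 2 ∉ A) hn₀N hn₀
  have hafter : ∀ m, n + 3 ≤ m → m ∈ A := by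
    intro m hm
    obtain ⟨k, rfl⟩ : ∃ k, m = k + 2 := ⟨m - 2, by omega⟩
    by_contra hk
    have hkN : k ≤ N := by
      by_contra! h
      exact hk (hbig _ h.le)
    have := Nat.le_findGreatest (P := fun n => n + 2 ∉ A) hkN hk
    omega
  have hnot : n + 2 ∉ greedy x n := fun h => by
    have := greedy_bounds x n _ h
    omega
  refine ⟨insert (n + 2) (greedy x n), n + 2, ?_, Set.mem_insert_of_mem _ (one_mem_greedy x n),
    ?_, Set.mem_insert _ _, ?_, by omega, ?_, ?_⟩
  · refine (Set.finite_Iic (n + 2)).subset ?_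
    rintro m (rfl | hm)
    · simp
    · have := greedy_bounds x n m hm
      simp only [Set.mem_Iic]
      omega
  · rintro m (rfl | hm)
    · omega
    · exact (greedy_bounds x n m hm).1
  · rintro m (rfl | hm)
    · rfl
    · have := greedy_bounds x n m hm
      omega
  · refine lt_of_eq_of_lt (congrArg H (Set.ext fun m => ?_)) hlt
    rw [Set.insert_sdiff_self_of_notMem hnot]
    constructor
    · rintro (hm | hm)
      · exact Set.mem_iUnion.2 ⟨n, hm⟩
      · exact hafter m hm
    · intro hm
      rcases lt_trichotomy m (n + 2) with h | rfl | h
      · exact Or.inl ((mem_greedy_iff x (by omega)).2 hm)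
      · exact absurd hm hnA
      · exact Or.inr h
  · exact lt_H_insert_greedy fun h => hnA (Set.mem_iUnion.2 ⟨_, h⟩)

end Greedy

/-- No value of `H` lies strictly between the two ends of a gap. -/
lemma H_le_or_le_H {S₁ S : Set ℕ} {t : ℕ} (h1 : 1 ∈ S₁) (ht : t ∈ S₁) (hmax : ∀ m ∈ S₁, m ≤ t)
    (ht1 : 1 < t) (hS : 1 ∈ S) (hSpos : ∀ n ∈ S, 0 < n) (hpos : ∀ n ∈ S₁, 0 < n) :
    H S ≤ H ((S₁ \ {t}) ∪ {m : ℕ | t + 1 ≤ m}) ∨ H S₁ ≤ H S := by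
  by_cases hne : ∃ m, ¬(m ∈ S ↔ m ∈ S₁)
  · set d := Nat.find hne
    have hdiff : ¬(d ∈ S ↔ d ∈ S₁) := Nat.find_spec hne
    have hbelow : ∀ m < d, m ∈ S ↔ m ∈ S₁ := fun m hm => not_not.1 (Nat.find_min hne hm)
    by_cases hdS : d ∈ S
    · have hd1 : d ∉ S₁ := fun h => hdiff ⟨fun _ => h, fun _ => hdS⟩
      exact Or.inr (H_lt_H_of_lex hS h1 (hSpos d hdS) hdS hd1 hbelow).le
    · have hd1 : d ∈ S₁ := by tauto
      rcases (hmax d hd1).lt_or_eq with hlt | heq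
      · refine Or.inl (H_lt_H_of_lex (t := d) (Or.inl ⟨h1, ht1.ne⟩) hS (hpos d hd1)
          (Or.inl ⟨hd1, hlt.ne⟩) hdS fun m hm => ?_).le
        rw [hbelow m hm]
        simp only [Set.mem_union, Set.mem_sdiff, Set.mem_singleton_iff, Set.mem_ofPred_eq]
        constructor
        · rintro (h | h)
          · exact h.1
          · omega
        · exact fun h => Or.inl ⟨h, by omega⟩
      · refine Or.inl (H_mono hS fun m hm => ?_)
        rcases lt_trichotomy m t with h | rfl | h
        · exact Or.inl ⟨(hbelow m (heq ▸ h)).1 hm, h.ne⟩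
        · exact absurd (heq ▸ hm) hdS
        · exact Or.inr h
  · push Not at hne
    rw [Set.ext hne]
    exact Or.inr le_rfl

theorem complement_eq_union_of_gaps :
    Set.Icc (6 / Real.pi ^ 2) 1 \ densitySet =
      {x : ℝ | ∃ S₁ : Set ℕ, ∃ t : ℕ, S₁.Finite ∧ 1 ∈ S₁ ∧ (∀ n ∈ S₁, 0 < n) ∧
        t ∈ S₁ ∧ (∀ m ∈ S₁, m ≤ t) ∧ 1 < t ∧
        x ∈ Set.Ioo (H ((S₁ \ {t}) ∪ {m : ℕ | t + 1 ≤ m})) (H S₁)} := by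
  ext x
  constructor
  · rintro ⟨⟨hx, hx1⟩, hD⟩
    exact exists_gap hx hx1 hD
  · rintro ⟨S₁, t, -, h1, hpos, ht, hmax, ht1, hlo, hhi⟩
    have h1' : 1 ∈ (S₁ \ {t}) ∪ {m : ℕ | t + 1 ≤ m} := Or.inl ⟨h1, ht1.ne⟩
    refine ⟨⟨?_, ?_⟩, ?_⟩
    · rw [← H_singleton_one]
      exact (H_mono (Set.mem_singleton 1) (Set.singleton_subset_iff.2 h1')).trans hlo.le
    · rw [← H_positives]
      exact hhi.le.trans (H_mono h1 hpos)
    · rintro ⟨S, hS, hSpos, rfl⟩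
      rcases H_le_or_le_H h1 ht hmax ht1 hS hSpos hpos with h | h <;> linarith
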